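/- There exists a constant c > 0 such that for every forest H on at least 2 vertices, every regular graph of girth at least 5 that contains no induced subgraph isomorphic to H has chromatic number at most c·|V(H)|/log|V(H)|. -/

import Mathlib

open Finset Classical in
/-- Lopsided Lovász local lemma, in counting form and with uniform bounds. -/
theorem Finset.exists_forall_not_of_local_lemma {ι Ω : Type*} [Fintype ι] (X : Finset Ω)
    (hX : X.Nonempty) (bad : ι → Ω → Prop) (Γ : ι → Finset ι) (p : ℝ) (d : ℕ) (hd : 0 < d)
    (hΓ : ∀ i, (Γ i).card ≤ d) (hp : 4 * p * d ≤ 1) (hp0 : 0 ≤ p)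
    (h : ∀ i (S : Finset ι), Disjoint S (Γ i) →
      (({f ∈ X | bad i f ∧ ∀ j ∈ S, ¬ bad j f} : Finset Ω).card : ℝ) ≤
        p * ({f ∈ X | ∀ j ∈ S, ¬ bad j f} : Finset Ω).card) :
    ∃ f ∈ X, ∀ i, ¬ bad i f := by
  have key : ∀ (m : ℕ) (S : Finset ι), S.card = m → ∀ i,
      (({f ∈ X | bad i f ∧ ∀ j ∈ S, ¬ bad j f} : Finset Ω).card : ℝ) ≤
        2 * p * ({f ∈ X | ∀ j ∈ S, ¬ bad j f} : Finset Ω).card := by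
    intro m
    induction m using Nat.strong_induction_on with
    | _ m ih =>
      intro S hS i
      have hle : (({f ∈ X | bad i f ∧ ∀ j ∈ S, ¬ bad j f} : Finset Ω).card : ℝ) ≤
          ({f ∈ X | bad i f ∧ ∀ j ∈ S \ Γ i, ¬ bad j f} : Finset Ω).card := by
        refine Nat.cast_le.2 (card_le_card fun f hf => ?_)
        rw [mem_filter] at hf ⊢
        exact ⟨hf.1, hf.2.1, fun j hj => hf.2.2 j (mem_sdiff.1 hj).1⟩
      have hle2 := hle.trans (h i (S \ Γ i) sdiff_disjoint)
      by_cases hS1 : S ∩ Γ i = ∅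
      · rw [sdiff_eq_self_of_disjoint (disjoint_iff_inter_eq_empty.2 hS1)] at hle2
        refine hle2.trans ?_
        gcongr
        linarith
      · have hlt : (S \ Γ i).card < m := by
          have h1 := card_sdiff_add_card_inter S (Γ i)
          have h2 := card_pos.2 (nonempty_iff_ne_empty.2 hS1)
          omega
        have hsub : ({f ∈ X | ∀ j ∈ S \ Γ i, ¬ bad j f} : Finset Ω) ⊆
            {f ∈ X | ∀ j ∈ S, ¬ bad j f} ∪
              (S ∩ Γ i).biUnion fun x => {f ∈ X | bad x f ∧ ∀ j ∈ S \ Γ i, ¬ bad j f} := by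
          intro f hf
          rw [mem_filter] at hf
          rw [mem_union, mem_biUnion, mem_filter]
          by_cases hb : ∃ x ∈ S ∩ Γ i, bad x f
          · obtain ⟨x, hx, hxb⟩ := hb
            exact Or.inr ⟨x, hx, mem_filter.2 ⟨hf.1, hxb, hf.2⟩⟩
          · push Not at hb
            refine Or.inl ⟨hf.1, fun j hj => ?_⟩
            by_cases hjΓ : j ∈ Γ i
            · exact hb j (mem_inter.2 ⟨hj, hjΓ⟩)
            · exact hf.2 j (mem_sdiff.2 ⟨hj, hjΓ⟩)
        have hcard : (({f ∈ X | ∀ j ∈ S \ Γ i, ¬ bad j f} : Finset Ω).card : ℝ) ≤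
            ({f ∈ X | ∀ j ∈ S, ¬ bad j f} : Finset Ω).card + ∑ x ∈ S ∩ Γ i,
              (({f ∈ X | bad x f ∧ ∀ j ∈ S \ Γ i, ¬ bad j f} : Finset Ω).card : ℝ) := by
          exact_mod_cast (card_le_card hsub).trans ((card_union_le _ _).trans
            (Nat.add_le_add_left card_biUnion_le _))
        have hsum := sum_le_sum fun x (_ : x ∈ S ∩ Γ i) => ih _ hlt (S \ Γ i) rfl x
        rw [sum_const, nsmul_eq_mul] at hsum
        have hint : ((S ∩ Γ i).card : ℝ) ≤ d := by
          exact_mod_cast (card_le_card inter_subset_right).trans (hΓ i)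
        set N : ℝ := (({f ∈ X | ∀ j ∈ S \ Γ i, ¬ bad j f} : Finset Ω).card : ℝ)
        have hN : 0 ≤ N := Nat.cast_nonneg _
        have h1 : ((S ∩ Γ i).card : ℝ) * (2 * p * N) ≤ d * (2 * p * N) := by gcongr
        have h2 : 4 * p * d * N ≤ 1 * N := by gcongr
        have h3 : N ≤ 2 * (({f ∈ X | ∀ j ∈ S, ¬ bad j f} : Finset Ω).card : ℝ) := by
          linarith
        refine hle2.trans ?_
        have := mul_le_mul_of_nonneg_left h3 hp0
        linarith
  have pos : ∀ S : Finset ι, 0 < ({f ∈ X | ∀ j ∈ S, ¬ bad j f} : Finset Ω).card := by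
    intro S
    induction S using Finset.induction_on with
    | empty => simpa using hX
    | insert i S hi ihS =>
      have hk := key _ S rfl i
      have hsplit := card_filter_add_card_filter_not (s := {f ∈ X | ∀ j ∈ S, ¬ bad j f}) (bad i)
      rw [filter_filter, filter_filter] at hsplit
      have e1 : ({f ∈ X | (∀ j ∈ S, ¬ bad j f) ∧ bad i f} : Finset Ω) =
          {f ∈ X | bad i f ∧ ∀ j ∈ S, ¬ bad j f} := filter_congr fun _ _ => and_comm
      have e2 : ({f ∈ X | (∀ j ∈ S, ¬ bad j f) ∧ ¬ bad i f} : Finset Ω) =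
          {f ∈ X | ∀ j ∈ insert i S, ¬ bad j f} := filter_congr fun _ _ => by
        rw [forall_mem_insert]; exact and_comm
      rw [e1, e2] at hsplit
      have h1 : p ≤ 1 / 4 := by
        have : (1 : ℝ) ≤ d := by exact_mod_cast hd
        nlinarith
      have ihS' : (0 : ℝ) < ({f ∈ X | ∀ j ∈ S, ¬ bad j f} : Finset Ω).card := by
        exact_mod_cast ihS
      have hs : (({f ∈ X | bad i f ∧ ∀ j ∈ S, ¬ bad j f} : Finset Ω).card : ℝ) +
          ({f ∈ X | ∀ j ∈ insert i S, ¬ bad j f} : Finset Ω).card =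
          ({f ∈ X | ∀ j ∈ S, ¬ bad j f} : Finset Ω).card := by exact_mod_cast hsplit
      have : (0 : ℝ) < ({f ∈ X | ∀ j ∈ insert i S, ¬ bad j f} : Finset Ω).card := by nlinarith
      exact_mod_cast this
  obtain ⟨f, hf⟩ := card_pos.1 (pos univ)
  exact ⟨f, (mem_filter.1 hf).1, fun i => (mem_filter.1 hf).2 i (mem_univ i)⟩

open Finset in
theorem Finset.one_add_sum_le_prod_one_add {ι : Type*} (s : Finset ι) (f : ι → ℝ)
    (hf : ∀ i ∈ s, 0 ≤ f i) : 1 + ∑ i ∈ s, f i ≤ ∏ i ∈ s, (1 + f i) := by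
  classical
  induction s using Finset.induction_on with
  | empty => simp
  | insert i s hi ih =>
    rw [forall_mem_insert] at hf
    rw [sum_insert hi, prod_insert hi]
    have h1 := ih hf.2
    have h2 := mul_le_mul_of_nonneg_left h1 (by linarith [hf.1] : (0 : ℝ) ≤ 1 + f i)
    have h3 := mul_nonneg hf.1 (sum_nonneg hf.2)
    linarith

open Finset in
/-- Averaging over one coordinate of a product set. -/
theorem Finset.sum_piFinset_sum_update {ι κ : Type*} [Fintype ι] [DecidableEq ι]
    (t : ι → Finset κ) (i : ι) (F : (ι → κ) → ℝ) :
    ∑ f ∈ Fintype.piFinset t, ∑ b ∈ t i, F (Function.update f i b) =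
      (t i).card * ∑ f ∈ Fintype.piFinset t, F f := by
  have h : ∑ x ∈ Fintype.piFinset t ×ˢ t i, F (Function.update x.1 i x.2) =
      ∑ x ∈ Fintype.piFinset t ×ˢ t i, F x.1 := by
    have hmem : ∀ x ∈ Fintype.piFinset t ×ˢ t i,
        (Function.update x.1 i x.2, x.1 i) ∈ Fintype.piFinset t ×ˢ t i := by
      rintro ⟨f, b⟩ hx
      rw [mem_product, Fintype.mem_piFinset] at hx ⊢
      refine ⟨fun a => ?_, hx.1 i⟩
      by_cases ha : a = i
      · subst ha; simpa using hx.2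
      · simpa [ha] using hx.1 a
    exact sum_bij' (fun x _ => (Function.update x.1 i x.2, x.1 i))
      (fun x _ => (Function.update x.1 i x.2, x.1 i)) hmem hmem
      (fun x _ => by simp) (fun x _ => by simp) (fun x _ => rfl)
  rw [sum_product, sum_product] at h
  rw [h]
  simp [mul_sum]

open Finset in
theorem Finset.sum_prod_one_sub_le {C : Type*} [Fintype C] [DecidableEq C]
    (A : Finset (Option C)) (hA : A.Nonempty) (y : C → ℝ) (hy0 : ∀ a, 0 ≤ y a)
    (hy1 : ∀ a, y a < 1) :
    ∑ b ∈ A, ∏ a, (1 - if b = some a then 0 else y a) ≤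
      A.card * ∏ a, (1 - y a * if some a ∈ A then 1 - 1 / (A.card : ℝ) else 1) := by
  have hpos : ∀ a, 0 < 1 - y a := fun a => sub_pos.2 (hy1 a)
  have hm : (0 : ℝ) < A.card := by exact_mod_cast card_pos.2 hA
  have hP : 0 ≤ ∏ a, (1 - y a) := prod_nonneg fun a _ => (hpos a).le
  set z : C → ℝ := fun a => if some a ∈ A then y a / (1 - y a) else 0 with hz
  have hz0 : ∀ a, 0 ≤ z a := fun a => by
    simp only [hz]; split_ifs
    · exact div_nonneg (hy0 a) (hpos a).le
    · exact le_rfl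
  have hterm : ∀ b ∈ A, ∏ a, (1 - if b = some a then 0 else y a) =
      (∏ a, (1 - y a)) * (1 + ∑ a, if b = some a then z a else 0) := by
    intro b hb
    cases b with
    | none => simp
    | some β =>
      have h1 : z β = y β / (1 - y β) := by simp [hz, hb]
      have h2 := (hpos β).ne'
      simp only [Option.some.injEq, sum_ite_eq, mem_univ, if_true, h1]
      rw [← mul_prod_erase univ _ (mem_univ β), ← mul_prod_erase univ (fun a => 1 - y a)
        (mem_univ β)]
      have h3 : ∏ a ∈ univ.erase β, (1 - if β = a then 0 else y a) =
          ∏ a ∈ univ.erase β, (1 - y a) := prod_congr rfl fun a ha => by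
        rw [if_neg (ne_of_mem_erase ha).symm]
      rw [h3]
      simp only [if_true]
      field_simp
      ring
  have hfac : ∀ a, 1 - y a * (if some a ∈ A then 1 - 1 / (A.card : ℝ) else 1) =
      (1 - y a) * (1 + z a / A.card) := by
    intro a
    have h2 := (hpos a).ne'
    simp only [hz]
    split_ifs
    · field_simp
      ring
    · simp
  rw [sum_congr rfl hterm, prod_congr rfl fun a _ => hfac a, prod_mul_distrib, ← mul_sum,
    sum_add_distrib, sum_comm, ← mul_assoc, mul_comm (A.card : ℝ), mul_assoc]
  refine mul_le_mul_of_nonneg_left ?_ hP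
  have hs : ∀ a, ∑ b ∈ A, (if b = some a then z a else 0) = z a := by
    intro a
    rw [sum_ite_eq' A (some a) fun _ => z a]
    simp only [hz]; split_ifs <;> rfl
  simp only [hs, sum_const, nsmul_eq_mul, mul_one]
  calc (A.card : ℝ) + ∑ a, z a = A.card * (1 + ∑ a, z a / A.card) := by
        rw [← sum_div]; field_simp
    _ ≤ _ := by
        gcongr
        exact Finset.one_add_sum_le_prod_one_add _ _ fun a _ => div_nonneg (hz0 a) hm.le

open Finset in
/-- Exponential moment bound for the number of values missed by a random choice function. -/
theorem Finset.sum_piFinset_prod_one_sub_le {ι C : Type*} [Fintype ι] [DecidableEq ι]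
    [Fintype C] [DecidableEq C] (t : ι → Finset (Option C)) (ht : ∀ i, (t i).Nonempty)
    (s : Finset ι) (x : C → ℝ) (hx0 : ∀ a, 0 ≤ x a) (hx1 : ∀ a, x a < 1) :
    ∑ f ∈ Fintype.piFinset t, ∏ a, (1 - if ∃ i ∈ s, f i = some a then 0 else x a) ≤
      (Fintype.piFinset t).card *
        ∏ a, (1 - x a * ∏ i ∈ s, if some a ∈ t i then 1 - 1 / ((t i).card : ℝ) else 1) := by
  induction s using Finset.induction_on generalizing x with
  | empty => simp
  | insert i s hi ih =>
    have hm : (0 : ℝ) < (t i).card := by exact_mod_cast card_pos.2 (ht i)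
    have hm1 : (1 : ℝ) ≤ (t i).card := by exact_mod_cast card_pos.2 (ht i)
    set q : C → ℝ := fun a => if some a ∈ t i then 1 - 1 / ((t i).card : ℝ) else 1 with hq
    have hq0 : ∀ a, 0 ≤ q a := fun a => by
      simp only [hq]; split_ifs
      · rw [sub_nonneg, div_le_one hm]; exact hm1
      · exact zero_le_one
    have hq1 : ∀ a, q a ≤ 1 := fun a => by
      simp only [hq]; split_ifs
      · rw [sub_le_self_iff]; positivity
      · exact le_rfl
    have hstep : ∀ f : ι → Option C, ∑ b ∈ t i,
        ∏ a, (1 - if ∃ j ∈ insert i s, Function.update f i b j = some a then 0 else x a) ≤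
        (t i).card * ∏ a, (1 - if ∃ j ∈ s, f j = some a then 0 else x a * q a) := by
      intro f
      have := Finset.sum_prod_one_sub_le (t i) (ht i)
        (fun a => if ∃ j ∈ s, f j = some a then 0 else x a)
        (fun a => by split_ifs; exacts [le_rfl, hx0 a])
        (fun a => by split_ifs; exacts [zero_lt_one, hx1 a])
      convert this using 1
      · refine sum_congr rfl fun b _ => prod_congr rfl fun a _ => ?_
        have hiff : (∃ j ∈ insert i s, Function.update f i b j = some a) ↔
            b = some a ∨ ∃ j ∈ s, f j = some a := by
          rw [exists_mem_insert, Function.update_self]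
          refine or_congr_right (exists_congr fun j => and_congr_right fun hj => ?_)
          rw [Function.update_of_ne (ne_of_mem_of_not_mem hj hi)]
        rw [if_congr hiff rfl rfl, ite_or]
      · congr 1
        refine prod_congr rfl fun a _ => ?_
        by_cases h2 : ∃ j ∈ s, f j = some a
        · rw [if_pos h2, if_pos h2, zero_mul]
        · rw [if_neg h2, if_neg h2]
    have havg := Finset.sum_piFinset_sum_update t i fun f =>
      ∏ a, (1 - if ∃ j ∈ insert i s, f j = some a then 0 else x a)
    have hsum := sum_le_sum fun f (_ : f ∈ Fintype.piFinset t) => hstep f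
    rw [havg, ← mul_sum] at hsum
    refine (le_of_mul_le_mul_left hsum hm).trans ((ih (fun a => x a * q a)
      (fun a => mul_nonneg (hx0 a) (hq0 a))
      fun a => (mul_le_of_le_one_right (hx0 a) (hq1 a)).trans_lt (hx1 a)).trans_eq ?_)
    congr 1
    refine prod_congr rfl fun a _ => ?_
    rw [prod_insert hi, mul_assoc]

open Finset in
/-- For a uniformly random choice function `f` of `t`, fewer than `l` elements of `C` are missed
by `f` on `s` only with small probability. -/
theorem Finset.card_filter_missed_lt_le {ι C : Type*} [Fintype ι] [DecidableEq ι]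
    [Fintype C] [DecidableEq C] (t : ι → Finset (Option C)) (hne : ∀ i, (t i).Nonempty)
    (s : Finset ι) (ht : ∀ i ∈ s, none ∈ t i) (D : ℝ) (hD : (s.card : ℝ) ≤ D)
    (hC : 0 < Fintype.card C) (l : ℕ) :
    ((({f ∈ Fintype.piFinset t | ({a | ∀ i ∈ s, f i ≠ some a} : Finset C).card < l} :
      Finset (ι → Option C)).card : ℝ)) ≤
      (Fintype.piFinset t).card * (2 ^ l *
        Real.exp (-(Fintype.card C * Real.exp (-(D / Fintype.card C)) / 2))) := by
  set q : C → ℝ := fun a => ∏ i ∈ s, if some a ∈ t i then 1 - 1 / ((t i).card : ℝ) else 1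
    with hq
  set r : C → ℝ := fun a => ∑ i ∈ s, if some a ∈ t i then 1 / ((t i).card - 1 : ℝ) else 0
    with hr
  have hm2 : ∀ i ∈ s, ∀ a, some a ∈ t i → (2 : ℝ) ≤ (t i).card := fun i hi a h => by
    have : 1 < (t i).card := one_lt_card.2 ⟨_, ht i hi, _, h, by simp⟩
    exact_mod_cast this
  have hqr : ∀ a, Real.exp (-r a) ≤ q a := by
    intro a
    simp only [hq, hr]
    rw [← sum_neg_distrib, Real.exp_sum]
    refine prod_le_prod (fun i _ => (Real.exp_pos _).le) fun i hi => ?_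
    split_ifs with h
    · have h2 := hm2 i hi a h
      have h3 : (0 : ℝ) < (t i).card - 1 := by linarith
      rw [Real.exp_neg, inv_le_comm₀ (Real.exp_pos _) (by
        rw [sub_pos, div_lt_one] <;> linarith)]
      have h4 := Real.add_one_le_exp (1 / ((t i).card - 1 : ℝ))
      refine le_trans (le_of_eq ?_) h4
      have h5 : ((t i).card : ℝ) ≠ 0 := by linarith
      have h6 := h3.ne'
      field_simp
      ring
    · simp
  have hrsum : ∑ a, r a ≤ D := by
    simp only [hr]
    rw [sum_comm]
    refine le_trans ?_ hD
    rw [card_eq_sum_ones, Nat.cast_sum]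
    refine sum_le_sum fun i hi => ?_
    rw [← sum_filter, sum_const, nsmul_eq_mul]
    have hc : ({a | some a ∈ t i} : Finset C).card + 1 ≤ (t i).card := by
      rw [← card_erase_add_one (ht i hi), Nat.add_le_add_iff_right]
      refine card_le_card_of_injOn some (fun a ha => ?_) (fun a _ b _ h => Option.some_injective _ h)
      simpa using ha
    have hc' : (({a | some a ∈ t i} : Finset C).card : ℝ) ≤ (t i).card - 1 := by
      rw [le_sub_iff_add_le]; exact_mod_cast hc
    rw [mul_one_div, Nat.cast_one]
    exact div_le_one_of_le₀ hc' ((Nat.cast_nonneg _).trans hc')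
  set K : ℝ := (Fintype.card C : ℝ)
  have hK : 0 < K := by simpa [K] using hC
  have hqsum : K * Real.exp (-(D / K)) ≤ ∑ a, q a := by
    calc K * Real.exp (-(D / K))
        ≤ ∑ a, Real.exp (-(D / K)) * (1 + (D / K - r a)) := by
          rw [← mul_sum, sum_add_distrib, sum_sub_distrib]
          simp only [sum_const, card_univ, nsmul_eq_mul, mul_one]
          rw [mul_comm]
          gcongr
          change K ≤ K + (K * (D / K) - _)
          rw [mul_div_cancel₀ _ hK.ne']
          linarith
      _ ≤ ∑ a, q a := sum_le_sum fun a _ => by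
          refine le_trans ?_ (hqr a)
          have : -r a = -(D / K) + (D / K - r a) := by ring
          rw [this, Real.exp_add]
          gcongr
          linarith [Real.add_one_le_exp (D / K - r a)]
  have hq0 : ∀ a, 0 ≤ q a := fun a => (Real.exp_pos _).le.trans (hqr a)
  have hmom := Finset.sum_piFinset_prod_one_sub_le t hne s (fun _ => 1 / 2)
    (fun _ => by norm_num) (fun _ => by norm_num)
  have hprod : ∏ a, (1 - 1 / 2 * q a) ≤ Real.exp (-(K * Real.exp (-(D / K)) / 2)) := by
    have hq1 : ∀ a, q a ≤ 1 := fun a => prod_le_one (fun i hi => by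
        split_ifs with h
        · have := hm2 i hi a h
          rw [sub_nonneg, div_le_one] <;> linarith
        · exact zero_le_one) fun i _ => by
        split_ifs
        · rw [sub_le_self_iff]; positivity
        · exact le_rfl
    calc ∏ a, (1 - 1 / 2 * q a) ≤ ∏ a, Real.exp (-(1 / 2 * q a)) :=
          prod_le_prod (fun a _ => by linarith [hq1 a]) fun a _ =>
            Real.one_sub_le_exp_neg _
      _ = Real.exp (-((∑ a, q a) / 2)) := by
          rw [← Real.exp_sum, sum_neg_distrib, ← mul_sum]; ring_nf
      _ ≤ _ := by gcongr
  have hlow : ∀ f : ι → Option C,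
      ∏ a, (1 - if ∃ i ∈ s, f i = some a then 0 else (1 / 2 : ℝ)) =
        (1 / 2) ^ ({a | ∀ i ∈ s, f i ≠ some a} : Finset C).card := by
    intro f
    rw [← prod_const, prod_filter]
    refine prod_congr rfl fun a _ => ?_
    by_cases h : ∃ i ∈ s, f i = some a
    · rw [if_pos h, if_neg (by push Not; exact h), sub_zero]
    · rw [if_neg h, if_pos (by push Not at h; exact h)]; norm_num
  simp only [hlow] at hmom
  set B : Finset (ι → Option C) :=
    {f ∈ Fintype.piFinset t | ({a | ∀ i ∈ s, f i ≠ some a} : Finset C).card < l}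
  have hmarkov : (B.card : ℝ) * (1 / 2) ^ l ≤
      ∑ f ∈ Fintype.piFinset t, (1 / 2 : ℝ) ^ ({a | ∀ i ∈ s, f i ≠ some a} : Finset C).card := by
    rw [← nsmul_eq_mul, ← sum_const]
    refine (sum_le_sum fun f hf => ?_).trans
      (sum_le_sum_of_subset_of_nonneg (filter_subset _ _) fun _ _ _ => by positivity)
    exact pow_le_pow_of_le_one (by norm_num) (by norm_num) (mem_filter.1 hf).2.le
  have hfin : (B.card : ℝ) * (1 / 2) ^ l ≤
      (Fintype.piFinset t).card * Real.exp (-(K * Real.exp (-(D / K)) / 2)) :=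
    hmarkov.trans (hmom.trans (by gcongr))
  have h2 : (B.card : ℝ) = B.card * (1 / 2) ^ l * 2 ^ l := by
    rw [mul_assoc, ← mul_pow]; norm_num
  rw [h2]
  calc _ ≤ (Fintype.piFinset t).card * Real.exp (-(K * Real.exp (-(D / K)) / 2)) * 2 ^ l := by
        gcongr
    _ = _ := by ring

open Finset in
/-- A uniformly random choice function of `t` takes the value `none` more than `m` times on `B`
only with small probability. -/
theorem Finset.card_filter_none_ge_le {ι C : Type*} [Fintype ι] [DecidableEq ι]
    [DecidableEq C] (t : ι → Finset (Option C)) (B : Finset ι) (ht : ∀ i ∈ B, none ∈ t i) (D : ℝ)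
    (hD : (B.card : ℝ) ≤ D) (l : ℕ) (hl : 0 < l) (hB : ∀ i ∈ B, l ≤ (t i).card) (m : ℕ) :
    ((({f ∈ Fintype.piFinset t | m < ({i ∈ B | f i = none} : Finset ι).card} :
      Finset (ι → Option C)).card : ℝ)) ≤
      (Fintype.piFinset t).card * (Real.exp (D / l) * (1 / 2) ^ m) := by
  have hpt : ∀ f : ι → Option C, ∏ i, (if i ∈ B ∧ f i = none then (2 : ℝ) else 1) =
      2 ^ ({i ∈ B | f i = none} : Finset ι).card := by
    intro f
    rw [prod_ite, prod_const, prod_const_one, mul_one]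
    congr 2
    ext i
    simp
  have hmom : ∑ f ∈ Fintype.piFinset t, (2 : ℝ) ^ ({i ∈ B | f i = none} : Finset ι).card ≤
      (Fintype.piFinset t).card * Real.exp (D / l) := by
    simp only [← hpt]
    rw [← prod_univ_sum t fun i b => if i ∈ B ∧ b = none then (2 : ℝ) else 1,
      Fintype.card_piFinset, Nat.cast_prod]
    have hi : ∀ i, ∑ b ∈ t i, (if i ∈ B ∧ b = none then (2 : ℝ) else 1) ≤
        (t i).card * Real.exp (if i ∈ B then 1 / (l : ℝ) else 0) := by
      intro i
      by_cases hiB : i ∈ B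
      · have hc : (0 : ℝ) < (t i).card := by exact_mod_cast card_pos.2 ⟨_, ht i hiB⟩
        have h1 : ∀ b : Option C, (if b = none then (2 : ℝ) else 1) =
            1 + if b = none then 1 else 0 := fun b => by split_ifs <;> norm_num
        simp only [hiB, true_and, if_true, h1]
        rw [sum_add_distrib, sum_ite_eq' (t i) none fun _ => (1 : ℝ), if_pos (ht i hiB), sum_const,
          nsmul_eq_mul, mul_one]
        have h2 : 1 / ((t i).card : ℝ) ≤ 1 / l := by
          gcongr
          exact hB i hiB
        calc ((t i).card : ℝ) + 1 = (t i).card * (1 / (t i).card + 1) := by field_simp; ring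
          _ ≤ _ := by gcongr; linarith [Real.add_one_le_exp (1 / (l : ℝ))]
      · simp [hiB]
    refine (prod_le_prod (fun i _ => sum_nonneg fun b _ => by split_ifs <;> norm_num)
      fun i _ => hi i).trans ?_
    rw [prod_mul_distrib, ← Real.exp_sum]
    gcongr
    rw [← sum_filter, sum_const, nsmul_eq_mul, mul_one_div]
    gcongr
    simpa using hD
  set X : Finset (ι → Option C) :=
    {f ∈ Fintype.piFinset t | m < ({i ∈ B | f i = none} : Finset ι).card}
  have hmarkov : (X.card : ℝ) * 2 ^ m ≤
      ∑ f ∈ Fintype.piFinset t, (2 : ℝ) ^ ({i ∈ B | f i = none} : Finset ι).card := by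
    rw [← nsmul_eq_mul, ← sum_const]
    refine (sum_le_sum fun f hf => ?_).trans
      (sum_le_sum_of_subset_of_nonneg (filter_subset _ _) fun _ _ _ => by positivity)
    exact pow_le_pow_right₀ (by norm_num) (mem_filter.1 hf).2.le
  have h2 : (X.card : ℝ) = X.card * 2 ^ m * (1 / 2) ^ m := by
    rw [mul_assoc, ← mul_pow]; norm_num
  rw [h2]
  calc _ ≤ (Fintype.piFinset t).card * Real.exp (D / l) * (1 / 2) ^ m := by
        exact mul_le_mul_of_nonneg_right (hmarkov.trans hmom) (by positivity)
    _ = _ := by ring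

namespace SimpleGraph

variable {V W : Type*}

theorem not_adj_of_five_le_egirth {G : SimpleGraph V} (hG : (5 : ℕ∞) ≤ G.egirth) {a b c : V}
    (hab : G.Adj a b) (hbc : G.Adj b c) : ¬ G.Adj a c := by
  intro hac
  have h := le_egirth.1 hG a (.cons hab (.cons hbc (.cons hac.symm .nil))) (by
    rw [Walk.cons_isCycle_iff]
    simp [hab.ne, hbc.ne, hac.ne, hab.ne', hac.ne'])
  revert h
  simp only [Walk.length_cons, Walk.length_nil]
  norm_num

theorem eq_of_common_neighbors_of_five_le_egirth {G : SimpleGraph V} (hG : (5 : ℕ∞) ≤ G.egirth)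
    {x y a b : V} (hxy : x ≠ y) (hxa : G.Adj x a) (hxb : G.Adj x b) (hya : G.Adj y a)
    (hyb : G.Adj y b) : a = b := by
  by_contra hab
  have h := le_egirth.1 hG x (.cons hxa (.cons hya.symm (.cons hyb (.cons hxb.symm .nil)))) (by
    rw [Walk.cons_isCycle_iff]
    simp [hxa.ne, hxb.ne, hyb.ne, hxa.ne', hxb.ne', hya.ne', hab, hxy, hxy.symm])
  revert h
  simp only [Walk.length_cons, Walk.length_nil]
  norm_num

theorem IsAcyclic.exists_subsingleton_neighborSet [Finite W] [Nonempty W] {H : SimpleGraph W}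
    (hH : H.IsAcyclic) : ∃ v, (H.neighborSet v).Subsingleton := by
  classical
  have := Fintype.ofFinite W
  rcases subsingleton_or_nontrivial W with hW | hW
  · exact ⟨Classical.arbitrary W, fun a _ b _ => Subsingleton.elim a b⟩
  · obtain ⟨T, hT, -, hHT⟩ := connected_top.exists_isTree_le_of_le_of_isAcyclic le_top hH
    obtain ⟨v, hv⟩ := hHT.exists_vert_degree_one_of_nontrivial
    obtain ⟨w, hw⟩ := Finset.card_eq_one.1 hv
    have key : ∀ a ∈ H.neighborSet v, a = w := fun a ha => by
      have : a ∈ T.neighborFinset v := by simpa using hT ha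
      simpa [hw] using this
    exact ⟨v, fun a ha b hb => (key a ha).trans (key b hb).symm⟩

theorem exists_adj_forall_not_adj {G : SimpleGraph V} [Fintype V] [DecidableRel G.Adj]
    (hG : (5 : ℕ∞) ≤ G.egirth) (x : V) (S : Finset V) (hx : x ∉ S) (hS : S.card < G.degree x) :
    ∃ y, G.Adj x y ∧ y ∉ S ∧ ∀ z ∈ S, ¬ G.Adj y z := by
  classical
  by_contra! h
  have hsub : G.neighborFinset x ⊆
      S.biUnion fun z => {y ∈ G.neighborFinset x | y = z ∨ G.Adj y z} := by
    intro y hy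
    rw [mem_neighborFinset] at hy
    simp only [Finset.mem_biUnion, Finset.mem_filter, mem_neighborFinset]
    by_cases hyS : y ∈ S
    · exact ⟨y, hyS, hy, Or.inl rfl⟩
    · obtain ⟨z, hz, hyz⟩ := h y hy hyS
      exact ⟨z, hz, hy, Or.inr hyz⟩
  have hcard := (Finset.card_le_card hsub).trans (Finset.card_biUnion_le_card_mul _ _ 1 ?_)
  · rw [card_neighborFinset_eq_degree] at hcard
    omega
  · intro z hz
    rw [Finset.card_le_one]
    have hxz : x ≠ z := fun h => hx (h ▸ hz)
    simp only [Finset.mem_filter, mem_neighborFinset]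
    rintro a ⟨hxa, ha⟩ b ⟨hxb, hb⟩
    rcases ha with rfl | ha <;> rcases hb with rfl | hb
    · rfl
    · exact (not_adj_of_five_le_egirth hG hxb hb hxa).elim
    · exact (not_adj_of_five_le_egirth hG hxa ha hxb).elim
    · exact eq_of_common_neighbors_of_five_le_egirth hG hxz hxa hxb ha.symm hb.symm

/-- A nonempty graph of girth at least five and minimum degree at least `|H|` contains every
forest `H` as an induced subgraph. -/
theorem IsAcyclic.nonempty_embedding [Fintype W] [Fintype V] [Nonempty V] {H : SimpleGraph W}
    (hH : H.IsAcyclic) {G : SimpleGraph V} [DecidableRel G.Adj] (hG : (5 : ℕ∞) ≤ G.egirth)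
    (hdeg : ∀ v, Fintype.card W ≤ G.degree v) : Nonempty (H ↪g G) := by
  classical
  suffices ∀ (m : ℕ) (T : Finset W), T.card = m → ∃ φ : W → V, Set.InjOn φ T ∧
      ∀ a ∈ T, ∀ b ∈ T, (G.Adj (φ a) (φ b) ↔ H.Adj a b) by
    obtain ⟨φ, hφ, h⟩ := this _ Finset.univ rfl
    exact ⟨⟨⟨φ, fun a b hab => hφ (by simp) (by simp) hab⟩,
      fun {a b} => h a (Finset.mem_univ a) b (Finset.mem_univ b)⟩⟩
  intro m
  induction m with
  | zero =>
    intro T hT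
    obtain rfl := Finset.card_eq_zero.1 hT
    exact ⟨fun _ => Classical.arbitrary V, by simp, by simp⟩
  | succ m ih =>
    intro T hT
    have : Nonempty (T : Set W) := by
      obtain ⟨t, ht⟩ := Finset.card_pos.1 (by omega : 0 < T.card)
      exact ⟨⟨t, ht⟩⟩
    obtain ⟨⟨v, hvT⟩, hv⟩ := (hH.induce (T : Set W)).exists_subsingleton_neighborSet
    have hvT : v ∈ T := hvT
    have hv : ∀ a ∈ T, ∀ b ∈ T, H.Adj v a → H.Adj v b → a = b := fun a ha b hb h1 h2 => by
      simpa using hv (show (⟨a, ha⟩ : (T : Set W)) ∈ _ from h1)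
        (show (⟨b, hb⟩ : (T : Set W)) ∈ _ from h2)
    obtain ⟨φ, hφ, hadj⟩ := ih (T.erase v) (by rw [Finset.card_erase_of_mem hvT]; omega)
    have hcard : ((T.erase v).image φ).card < Fintype.card W := by
      have h1 := Finset.card_image_le (s := T.erase v) (f := φ)
      have h2 := Finset.card_le_univ T
      rw [Finset.card_erase_of_mem hvT] at h1
      omega
    obtain ⟨y, hy, hyadj⟩ : ∃ y, y ∉ (T.erase v).image φ ∧
        ∀ a ∈ T.erase v, (G.Adj y (φ a) ↔ H.Adj v a) := by
      by_cases hex : ∃ u ∈ T.erase v, H.Adj v u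
      · obtain ⟨u, hu, hvu⟩ := hex
        obtain ⟨y, hxy, hyS, hyz⟩ := exists_adj_forall_not_adj hG (φ u)
          (((T.erase v).image φ).erase (φ u)) (by simp)
          (((Finset.card_erase_le).trans_lt hcard).trans_le (hdeg _))
        refine ⟨y, fun h => hyS (Finset.mem_erase.2 ⟨hxy.ne', h⟩), fun a ha => ?_⟩
        by_cases hau : a = u
        · subst hau
          exact ⟨fun _ => hvu, fun _ => hxy.symm⟩
        · refine iff_of_false (hyz _ (Finset.mem_erase.2 ⟨fun h => hau (hφ ha hu h),
            Finset.mem_image_of_mem φ ha⟩)) fun h => hau ?_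
          exact hv a (Finset.mem_of_mem_erase ha) u (Finset.mem_of_mem_erase hu) h hvu
      · push Not at hex
        obtain ⟨x, hx⟩ : ∃ x, x ∉ (T.erase v).image φ := by
          by_contra! hall
          have h1 := Finset.card_le_card (fun x _ => hall x : Finset.univ ⊆ (T.erase v).image φ)
          have h2 := G.degree_lt_card_verts (Classical.arbitrary V)
          have h3 := hdeg (Classical.arbitrary V)
          rw [Finset.card_univ] at h1
          omega
        obtain ⟨y, -, hyS, hyz⟩ := exists_adj_forall_not_adj hG x _ hx (hcard.trans_le (hdeg x))
        exact ⟨y, hyS, fun a ha => iff_of_false (hyz _ (Finset.mem_image_of_mem φ ha)) (hex a ha)⟩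
    have hne : ∀ a ∈ T, a ≠ v → a ∈ T.erase v := fun a ha h => Finset.mem_erase.2 ⟨h, ha⟩
    have hyne : ∀ a ∈ T.erase v, φ a ≠ y := fun a ha h => hy (h ▸ Finset.mem_image_of_mem φ ha)
    refine ⟨Function.update φ v y, fun a ha b hb hab => ?_, fun a ha b hb => ?_⟩
    · by_cases hav : a = v <;> by_cases hbv : b = v
      · rw [hav, hbv]
      · subst hav
        rw [Function.update_self, Function.update_of_ne hbv] at hab
        exact (hyne b (hne b hb hbv) hab.symm).elim
      · subst hbv
        rw [Function.update_self, Function.update_of_ne hav] at hab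
        exact (hyne a (hne a ha hav) hab).elim
      · rw [Function.update_of_ne hav, Function.update_of_ne hbv] at hab
        exact hφ (hne a ha hav) (hne b hb hbv) hab
    · by_cases hav : a = v <;> by_cases hbv : b = v
      · simp [hav, hbv]
      · subst hav
        rw [Function.update_self, Function.update_of_ne hbv]
        exact hyadj b (hne b hb hbv)
      · subst hbv
        rw [Function.update_self, Function.update_of_ne hav, G.adj_comm, H.adj_comm]
        exact hyadj a (hne a ha hav)
      · rw [Function.update_of_ne hav, Function.update_of_ne hbv]
        exact hadj a (hne a ha hav) b (hne b hb hbv)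

/-- Greedy colouring. -/
theorem colorable_of_card_neighbors_le [Fintype V] (G : SimpleGraph V) (d : ℕ)
    (hd : ∀ v, {w | G.Adj v w}.ncard ≤ d) : G.Colorable (d + 1) := by
  classical
  suffices ∀ T : Finset V, ∃ c : V → Fin (d + 1), ∀ a ∈ T, ∀ b ∈ T, G.Adj a b → c a ≠ c b by
    obtain ⟨c, hc⟩ := this Finset.univ
    exact ⟨Coloring.mk c fun {a b} h => hc a (by simp) b (by simp) h⟩
  intro T
  induction T using Finset.induction_on with
  | empty => exact ⟨fun _ => 0, by simp⟩
  | insert v T hv ih =>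
    obtain ⟨c, hc⟩ := ih
    have hcard : (c '' {w | G.Adj v w}).ncard < (Set.univ : Set (Fin (d + 1))).ncard := by
      rw [Set.ncard_univ, Nat.card_eq_fintype_card, Fintype.card_fin]
      exact (Set.ncard_image_le (Set.toFinite _)).trans_lt (Nat.lt_succ_of_le (hd v))
    obtain ⟨x, -, hx⟩ := Set.exists_mem_notMem_of_ncard_lt_ncard hcard
    have hx : ∀ w, G.Adj v w → c w ≠ x := fun w hw h => hx ⟨w, hw, h⟩
    refine ⟨Function.update c v x, fun a ha b hb hab => ?_⟩
    by_cases hav : a = v <;> by_cases hbv : b = v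
    · exact (hab.ne (hav.trans hbv.symm)).elim
    · subst hav
      rw [Function.update_self, Function.update_of_ne hbv]
      exact (hx b hab).symm
    · subst hbv
      rw [Function.update_self, Function.update_of_ne hav]
      exact hx a hab.symm
    · rw [Function.update_of_ne hav, Function.update_of_ne hbv]
      exact hc a (Finset.mem_of_mem_insert_of_ne ha hav) b
        (Finset.mem_of_mem_insert_of_ne hb hbv) hab

end SimpleGraph

/-- Bound the size of `X.filter P` by that of `X.filter Q` on each fibre of `e` separately. -/
theorem Finset.card_filter_le_mul_of_fiberwise {Ω Ω' : Type*} (X : Finset Ω) (P Q : Ω → Prop)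
    [DecidablePred P] [DecidablePred Q] (e : Ω → Ω') (p : ℝ) (hp : 0 ≤ p)
    (h : ∀ f₀ ∈ X, P f₀ → ∃ Y Z : Finset Ω, (∀ f ∈ X, P f → e f = e f₀ → f ∈ Y) ∧
      (∀ f ∈ Z, f ∈ X ∧ Q f ∧ e f = e f₀) ∧ (Y.card : ℝ) ≤ p * Z.card) :
    ((X.filter P).card : ℝ) ≤ p * (X.filter Q).card := by
  classical
  rw [Finset.card_eq_sum_card_image e (X.filter P), Nat.cast_sum]
  have hQ : ∑ g ∈ (X.filter P).image e, ((({f ∈ X.filter Q | e f = g} : Finset Ω).card : ℕ) : ℝ) ≤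
      (X.filter Q).card := by
    rw [← Nat.cast_sum, Nat.cast_le]
    have := Finset.sum_card_fiberwise_eq_card_filter (X.filter Q) ((X.filter P).image e) e
    refine le_trans (le_of_eq ?_) (this.trans_le (Finset.card_filter_le _ _))
    congr!
  refine le_trans ?_ (mul_le_mul_of_nonneg_left hQ hp)
  rw [Finset.mul_sum]
  refine Finset.sum_le_sum fun g hg => ?_
  obtain ⟨f₀, hf₀, rfl⟩ := Finset.mem_image.1 hg
  obtain ⟨hf₀X, hf₀P⟩ := Finset.mem_filter.1 hf₀
  obtain ⟨Y, Z, hY, hZ, hYZ⟩ := h f₀ hf₀X hf₀P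
  calc _ ≤ (Y.card : ℝ) := by
        refine Nat.cast_le.2 (Finset.card_le_card fun f hf => ?_)
        simp only [Finset.mem_filter] at hf
        exact hY f hf.1.1 hf.1.2 hf.2
    _ ≤ p * Z.card := hYZ
    _ ≤ _ := by
        refine mul_le_mul_of_nonneg_left (Nat.cast_le.2 (Finset.card_le_card fun f hf => ?_)) hp
        simp only [Finset.mem_filter]
        exact ⟨⟨(hZ f hf).1, (hZ f hf).2.1⟩, (hZ f hf).2.2⟩

namespace SimpleGraph

variable {V C : Type*} [Fintype V] [Fintype C]

open Classical in
/-- The colours not used by the partial colouring `f` on the neighbours of `v`. -/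
noncomputable def availableColors (G : SimpleGraph V) (f : V → Option C) (v : V) : Finset C :=
  {a | ∀ w ∈ G.neighborFinset v, f w ≠ some a}

theorem availableColors_congr {G : SimpleGraph V} {f g : V → Option C} {v : V}
    (h : ∀ w, G.Adj v w → f w = g w) : G.availableColors f v = G.availableColors g v := by
  classical
  refine Finset.filter_congr fun a _ => forall₂_congr fun w hw => ?_
  rw [h w (by simpa using hw)]

open Classical in
/-- Under the local lemma condition `hp`, a triangle-free graph of maximum degree at most `D` has
a partial colouring with `K` colours whose uncoloured vertices span a subgraph of maximum
degree at most `m`, so it is `K + (m + 1)`-colourable. -/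
theorem colorable_of_local_lemma (G : SimpleGraph V) (htri : ∀ a b c, G.Adj a b → G.Adj b c →
    ¬ G.Adj a c) (D : ℕ) (hD : 0 < D) (hdeg : ∀ v, G.degree v ≤ D) (K l m : ℕ) (hK : 0 < K)
    (hl : 0 < l) (hp : 4 * (2 ^ l * Real.exp (-(K * Real.exp (-((D : ℝ) / K)) / 2)) +
      Real.exp ((D : ℝ) / l) * (1 / 2) ^ m) * ((D ^ 2 + D ^ 3 : ℕ) : ℝ) ≤ 1) :
    G.Colorable (K + (m + 1)) := by
  obtain ⟨bad, hbad⟩ : ∃ bad : V → (V → Option (Fin K)) → Prop, bad = fun u f =>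
    (G.availableColors f u).card < l ∨
      m < ({w ∈ G.neighborFinset u | f w = none ∧ l ≤ (G.availableColors f w).card} :
        Finset V).card := ⟨_, rfl⟩
  set X : Finset (V → Option (Fin K)) :=
    {f | ∀ u w, G.Adj u w → ∀ a, f u = some a → f w ≠ some a} with hX
  set N : Finset V → Finset V := fun s => s.biUnion fun v => G.neighborFinset v with hN
  have mem_N : ∀ s w, w ∈ N s ↔ ∃ v ∈ s, G.Adj v w := fun s w => by simp [hN]
  have card_N : ∀ s, (N s).card ≤ s.card * D := fun s =>
    Finset.card_biUnion_le_card_mul _ _ _ fun v _ => hdeg v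
  set Γ : V → Finset V := fun u => N (G.neighborFinset u) ∪ N (N (G.neighborFinset u)) with hΓ
  have card_Γ : ∀ u, (Γ u).card ≤ D ^ 2 + D ^ 3 := by
    intro u
    have h1 : (N (G.neighborFinset u)).card ≤ D ^ 2 :=
      (card_N _).trans (by rw [pow_two]; exact Nat.mul_le_mul_right _ (hdeg u))
    have h2 : (N (N (G.neighborFinset u))).card ≤ D ^ 3 :=
      (card_N _).trans (by rw [pow_succ D 2]; exact Nat.mul_le_mul_right _ h1)
    exact (Finset.card_union_le _ _).trans (Nat.add_le_add h1 h2)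
  have bad_congr : ∀ u x, x ∉ Γ u → ∀ f g : V → Option (Fin K),
      (∀ w, ¬ G.Adj u w → f w = g w) → (bad x f ↔ bad x g) := by
    intro u x hx f g hfg
    simp only [hΓ, Finset.mem_union, mem_N, mem_neighborFinset, not_or, not_exists, not_and] at hx
    have h1 : ∀ w, G.Adj x w → f w = g w := fun w hw => hfg w fun huw => hx.1 w huw hw.symm
    have h2 : ∀ w, G.Adj x w → G.availableColors f w = G.availableColors g w := fun w hw =>
      availableColors_congr fun y hy => hfg y fun huy => hx.2 w ⟨y, huy, hy.symm⟩ hw.symm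
    have h3 : ({w ∈ G.neighborFinset x | f w = none ∧ l ≤ (G.availableColors f w).card} :
        Finset V) = {w ∈ G.neighborFinset x | g w = none ∧ l ≤ (G.availableColors g w).card} :=
      Finset.filter_congr fun w hw => by
        rw [mem_neighborFinset] at hw
        rw [h1 w hw, h2 w hw]
    simp only [hbad]
    rw [availableColors_congr h1, h3]
  obtain ⟨f, hfX, hf⟩ := Finset.exists_forall_not_of_local_lemma X
    ⟨fun _ => none, by simp [hX]⟩ bad Γ
    (2 ^ l * Real.exp (-(K * Real.exp (-((D : ℝ) / K)) / 2)) +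
      Real.exp ((D : ℝ) / l) * (1 / 2) ^ m) (D ^ 2 + D ^ 3) (by positivity) card_Γ hp
    (by positivity) (by
      intro u S hS
      set p : ℝ := 2 ^ l * Real.exp (-(K * Real.exp (-((D : ℝ) / K)) / 2)) +
        Real.exp ((D : ℝ) / l) * (1 / 2) ^ m
      set e : (V → Option (Fin K)) → V → Option (Fin K) := fun f v =>
        if G.Adj u v then none else f v with he
      refine Finset.card_filter_le_mul_of_fiberwise X _ _ e p (by positivity)
        fun f₀ hf₀X hf₀ => ?_
      obtain ⟨-, hf₀S⟩ := hf₀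
      simp only [hX, Finset.mem_filter, Finset.mem_univ, true_and] at hf₀X
      set g := e f₀ with hg
      set t : V → Finset (Option (Fin K)) := fun w =>
        if G.Adj u w then Finset.insertNone (G.availableColors g w) else {g w} with ht
      have hagree : ∀ f, e f = g → ∀ w, ¬ G.Adj u w → f w = g w := fun f hf w hw => by
        rw [← hf]; simp [he, hw]
      have havail : ∀ f, e f = g → ∀ w, G.Adj u w →
          G.availableColors f w = G.availableColors g w := fun f hf w hw =>
        availableColors_congr fun x hx => hagree f hf x (htri u w x hw hx)
      have hfib₁ : ∀ f ∈ X, e f = g → f ∈ Fintype.piFinset t := by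
        intro f hfX hfg
        simp only [hX, Finset.mem_filter, Finset.mem_univ, true_and] at hfX
        refine Fintype.mem_piFinset.2 fun w => ?_
        by_cases hw : G.Adj u w
        · simp only [ht, hw, if_true, Finset.mem_insertNone]
          intro a ha
          rw [← havail f hfg w hw]
          simp only [availableColors, Finset.mem_filter, Finset.mem_univ, true_and,
            mem_neighborFinset]
          exact fun x hx => hfX w x hx a ha
        · simpa [ht, hw] using hagree f hfg w hw
      have hfib₂ : ∀ f ∈ Fintype.piFinset t, f ∈ X ∧ (∀ j ∈ S, ¬ bad j f) ∧ e f = g := by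
        intro f hf
        rw [Fintype.mem_piFinset] at hf
        simp only [hX, Finset.mem_filter, Finset.mem_univ, true_and]
        have hout : ∀ w, ¬ G.Adj u w → f w = g w := fun w hw => by
          simpa [ht, hw] using hf w
        have hin : ∀ w, G.Adj u w → ∀ a, f w = some a → ∀ x, G.Adj w x → g x ≠ some a := by
          intro w hw a ha
          have h1 := hf w
          simp only [ht, hw, if_true, Finset.mem_insertNone] at h1
          simpa [availableColors] using h1 a ha
        have hf₀g : ∀ w, ¬ G.Adj u w → f₀ w = g w := hagree f₀ rfl
        refine ⟨?_, fun j hj hb => hf₀S j hj ?_, ?_⟩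
        · intro v w hvw a hv hw
          by_cases huv : G.Adj u v
          · refine hin v huv a hv w hvw ?_
            rw [← hout w (htri u v w huv hvw), hw]
          · by_cases huw : G.Adj u w
            · refine hin w huw a hw v hvw.symm ?_
              rw [← hout v huv, hv]
            · refine hf₀X v w hvw a ?_ ?_
              · rw [hf₀g v huv, ← hout v huv, hv]
              · rw [hf₀g w huw, ← hout w huw, hw]
        · refine (bad_congr u j (Finset.disjoint_left.1 hS hj) f f₀ fun w hw => ?_).1 hb
          rw [hout w hw, hf₀g w hw]
        · funext w
          by_cases hw : G.Adj u w
          · simp [he, hg, hw]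
          · rw [← hout w hw]; simp [he, hw]
      have hne : ∀ w, (t w).Nonempty := fun w => by
        by_cases hw : G.Adj u w
        · simp only [ht, hw, if_true]
          exact ⟨none, by simp⟩
        · simp [ht, hw]
      have htn : ∀ w ∈ G.neighborFinset u, none ∈ t w := fun w hw => by
        rw [mem_neighborFinset] at hw
        simp [ht, hw]
      set B : Finset V := {w ∈ G.neighborFinset u | l ≤ (G.availableColors g w).card} with hB
      have hcN : ((G.neighborFinset u).card : ℝ) ≤ D := Nat.cast_le.2 (hdeg u)
      have h₁ := Finset.card_filter_missed_lt_le t hne (G.neighborFinset u) htn D hcN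
        (by simpa using hK) l
      have h₂ := Finset.card_filter_none_ge_le t B (fun w hw => htn w (Finset.mem_filter.1 hw).1) D
        ((Nat.cast_le.2 (Finset.card_le_card (Finset.filter_subset _ _))).trans hcN) l hl
        (fun w hw => by
          simp only [hB, Finset.mem_filter, mem_neighborFinset] at hw
          simp only [ht, hw.1, if_true, Finset.card_insertNone]
          exact hw.2.trans (Nat.le_succ _)) m
      rw [Fintype.card_fin] at h₁
      have h₃ := add_le_add h₁ h₂
      rw [← Nat.cast_add] at h₃
      have h₄ := (Nat.cast_le.2 (Finset.card_union_le _ _)).trans h₃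
      refine ⟨_, Fintype.piFinset t, ?_, hfib₂, h₄.trans_eq ?_⟩
      · rintro f hfX ⟨hfbad, -⟩ hfg
        have hft := hfib₁ f hfX hfg
        rw [Finset.mem_union, Finset.mem_filter, Finset.mem_filter]
        simp only [hbad] at hfbad
        refine hfbad.imp (fun h => ⟨hft, ?_⟩) fun h => ⟨hft, ?_⟩
        · convert h using 2
          unfold availableColors
          congr!
        · convert h using 2
          rw [hB, Finset.filter_filter]
          refine Finset.filter_congr fun w hw => ?_
          rw [mem_neighborFinset] at hw
          rw [havail f hfg w hw, and_comm]
      · simp only [p]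
        ring)
  have hcol : ∀ u, l ≤ (G.availableColors f u).card := fun u => by
    have := hf u
    simp only [hbad, not_or, not_lt] at this
    exact this.1
  simp only [hX, Finset.mem_filter, Finset.mem_univ, true_and] at hfX
  set G' : SimpleGraph V :=
    { Adj := fun v w => G.Adj v w ∧ f v = none ∧ f w = none
      symm := ⟨fun v w h => ⟨h.1.symm, h.2.2, h.2.1⟩⟩
      loopless := ⟨fun v h => G.loopless.irrefl v h.1⟩ } with hG'
  obtain ⟨c⟩ := G'.colorable_of_card_neighbors_le m fun v => by
    have := hf v
    simp only [hbad, not_or, not_lt] at this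
    refine le_trans ?_ this.2
    rw [← Set.ncard_coe_finset]
    refine Set.ncard_le_ncard (fun w hw => ?_) (Finset.finite_toSet _)
    rw [Finset.mem_coe, Finset.mem_filter, mem_neighborFinset]
    exact ⟨hw.1, hw.2.2, hcol w⟩
  have hcolor := (Coloring.mk (G := G) (fun v => match f v with
    | some a => Sum.inl a
    | none => (Sum.inr (c v) : Fin K ⊕ Fin (m + 1))) (fun {v w} hvw h => by
      cases hv : f v with
      | some a =>
        cases hw : f w with
        | some b =>
          simp only [hv, hw, Sum.inl.injEq] at h
          exact hfX v w hvw a hv (by rw [hw, h])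
        | none => simp [hv, hw] at h
      | none =>
        cases hw : f w with
        | some b => simp [hv, hw] at h
        | none =>
          simp only [hv, hw, Sum.inr.injEq] at h
          exact c.valid (show G'.Adj v w from ⟨hvw, hv, hw⟩) h)).colorable
  simpa using hcolor

end SimpleGraph

/-- Parameters meeting the local lemma condition for maximum degree `n` with `O(n / log n)`
colours. -/
theorem Real.exists_johansson_parameters {n : ℕ} (hn : 60 ≤ Real.log n) :
    ∃ K l m : ℕ, 0 < K ∧ 0 < l ∧
      4 * (2 ^ l * Real.exp (-(K * Real.exp (-((n : ℝ) / K)) / 2)) +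
        Real.exp ((n : ℝ) / l) * (1 / 2) ^ m) * ((n ^ 2 + n ^ 3 : ℕ) : ℝ) ≤ 1 ∧
      ((K + (m + 1) : ℕ) : ℝ) ≤ 60 * n / Real.log n := by
  set L := Real.log n with hL
  have hn0 : (0 : ℝ) < n := by
    rcases Nat.eq_zero_or_pos n with h | h
    · subst h; norm_num [hL] at hn
    · exact_mod_cast h
  have hL0 : 0 < L := by linarith
  have hexp : Real.exp L = n := Real.exp_log hn0
  have hcube (x : ℝ) (hx : 0 ≤ x) : x ^ 3 / 6 ≤ Real.exp x := by
    simpa [Nat.factorial] using Real.pow_div_factorial_le_exp x hx 3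
  have hnL : L ^ 2 / 6 ≤ n / L := by
    rw [le_div_iff₀ hL0, ← hexp]
    exact le_trans (by ring_nf; exact le_rfl) (hcube L hL0.le)
  have hq : 0 < n / L := by positivity
  set K := ⌈4 * (n / L)⌉₊ with hK
  have hK1 : 4 * (n / L) ≤ K := Nat.le_ceil _
  have hK2 : (K : ℝ) < 4 * (n / L) + 1 := Nat.ceil_lt_add_one (by positivity)
  have hK0 : (0 : ℝ) < K := by linarith
  set l := ⌈L⌉₊ with hl
  have hl1 : L ≤ l := Nat.le_ceil _
  have hl2 : (l : ℝ) < L + 1 := Nat.ceil_lt_add_one hL0.le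
  refine ⟨K, l, K, by exact_mod_cast hK0, by exact_mod_cast hL0.trans_le hl1, ?_, ?_⟩
  · have hquad : 4 * L + 4 ≤ 2 * (Real.exp (3 * L / 4) / L) := by
      have h := hcube (3 * L / 4) (by positivity)
      have : (2 * L + 2) ≤ Real.exp (3 * L / 4) / L := by
        rw [le_div_iff₀ hL0]
        nlinarith [mul_pos hL0 hL0]
      linarith
    have hnK : (n : ℝ) / K ≤ L / 4 := by
      rw [div_le_iff₀ hK0]
      calc (n : ℝ) = L / 4 * (4 * (n / L)) := by field_simp
        _ ≤ _ := by gcongr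
    have hsplit : 4 * (n / L) * Real.exp (-(L / 4)) = 4 * (Real.exp (3 * L / 4) / L) := by
      rw [← hexp, mul_assoc, div_mul_eq_mul_div, ← Real.exp_add]
      congr 3
      ring
    have h₁ : 2 ^ l * Real.exp (-(K * Real.exp (-((n : ℝ) / K)) / 2)) ≤
        Real.exp (-(3 * L) - 3) := by
      have h2 : (2 : ℝ) ^ l ≤ Real.exp (L + 1) := by
        calc (2 : ℝ) ^ l ≤ Real.exp 1 ^ l := by
              gcongr
              linarith [Real.add_one_le_exp 1]
          _ = Real.exp l := by rw [← Real.exp_nat_mul, mul_one]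
          _ ≤ _ := Real.exp_le_exp.2 hl2.le
      have h3 : 4 * (Real.exp (3 * L / 4) / L) ≤ K * Real.exp (-((n : ℝ) / K)) := by
        rw [← hsplit]
        gcongr
      calc _ ≤ Real.exp (L + 1) * Real.exp (-(K * Real.exp (-((n : ℝ) / K)) / 2)) := by gcongr
        _ = Real.exp (L + 1 + -(K * Real.exp (-((n : ℝ) / K)) / 2)) := (Real.exp_add _ _).symm
        _ ≤ _ := Real.exp_le_exp.2 (by linarith)
    have h₂ : Real.exp ((n : ℝ) / l) * (1 / 2) ^ K ≤ Real.exp (-(3 * L) - 3) := by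
      have h2 : ((1 : ℝ) / 2) ^ K ≤ Real.exp (-(K / 2)) := by
        calc ((1 : ℝ) / 2) ^ K ≤ Real.exp (-(1 / 2)) ^ K := by
              gcongr
              linarith [Real.add_one_le_exp (-(1 / 2) : ℝ)]
          _ = _ := by rw [← Real.exp_nat_mul]; congr 1; ring
      have h3 : (n : ℝ) / l ≤ n / L := by gcongr
      calc _ ≤ Real.exp (n / L) * Real.exp (-(K / 2)) := by gcongr
        _ = Real.exp (n / L + -(K / 2)) := (Real.exp_add _ _).symm
        _ ≤ _ := Real.exp_le_exp.2 (by nlinarith)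
    have h₃ : ((n ^ 2 + n ^ 3 : ℕ) : ℝ) ≤ 2 * Real.exp (3 * L) := by
      have h1 : Real.exp (3 * L) = (n : ℝ) ^ 3 := by rw [← hexp, ← Real.exp_nat_mul]; norm_num
      have h2 : (1 : ℝ) ≤ n := by exact_mod_cast hn0
      rw [h1]
      push_cast
      nlinarith [pow_pos hn0 2]
    have he : (16 : ℝ) ≤ Real.exp 3 := by
      have h := Real.exp_one_gt_d9
      have h1 : Real.exp 3 = Real.exp 1 ^ 3 := by rw [← Real.exp_nat_mul]; norm_num
      rw [h1]
      calc (16 : ℝ) ≤ 2.7 ^ 3 := by norm_num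
        _ ≤ _ := by gcongr; linarith
    calc _ ≤ 4 * (Real.exp (-(3 * L) - 3) + Real.exp (-(3 * L) - 3)) * (2 * Real.exp (3 * L)) := by
          gcongr
      _ = 16 * (Real.exp (-(3 * L) - 3) * Real.exp (3 * L)) := by ring
      _ = 16 * (Real.exp 3)⁻¹ := by rw [← Real.exp_add, ← Real.exp_neg]; ring_nf
      _ ≤ 1 := by rw [← div_eq_mul_inv, div_le_one (Real.exp_pos _)]; exact he
  · push_cast
    rw [mul_div_assoc]
    nlinarith

/-- there is c > 0 such that for every forest H on at least 2 vertices, every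
regular graph of girth at least 5 with no induced subgraph isomorphic to H has chromatic
number at most c·|V(H)|/log|V(H)|. -/
theorem regular_girth5_generalised_johansson :
    ∃ c : ℝ, 0 < c ∧
      ∀ (W : Type) [Fintype W] (H : SimpleGraph W), 2 ≤ Fintype.card W → H.IsAcyclic →
        ∀ (V : Type) [Fintype V] (G : SimpleGraph V) [DecidableRel G.Adj] (k : ℕ),
          G.IsRegularOfDegree k → (5 : ℕ∞) ≤ G.egirth →
          (¬ ∃ s : Set V, Nonempty ((G.induce s) ≃g H)) →
          (G.chromaticNumber.toNat : ℝ) ≤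
            c * (Fintype.card W : ℝ) / Real.log (Fintype.card W) := by
  refine ⟨60, by norm_num, fun W _ H hW hH V _ G _ k hreg hG hfree => ?_⟩
  set n := Fintype.card W with hn
  have hn2 : (2 : ℝ) ≤ n := by exact_mod_cast hW
  have hlog : 0 < Real.log n := Real.log_pos (by linarith)
  suffices h : ∃ q : ℕ, G.Colorable q ∧ (q : ℝ) ≤ 60 * n / Real.log n by
    obtain ⟨q, hq, hq'⟩ := h
    exact (Nat.cast_le.2 (ENat.toNat_le_of_le_natCast hq.chromaticNumber_le)).trans hq'
  rcases isEmpty_or_nonempty V with hV | hV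
  · exact ⟨0, SimpleGraph.Colorable.of_isEmpty 0, by rw [Nat.cast_zero]; positivity⟩
  have hk : k < n := by
    by_contra! hk
    obtain ⟨f⟩ := hH.nonempty_embedding hG fun v => hk.trans_eq (hreg v).symm
    exact hfree ⟨Set.range f, ⟨f.isoInduceRange.symm⟩⟩
  rcases le_or_gt 60 (Real.log n) with hL | hL
  · obtain ⟨K, l, m, hK, hl, hp, hle⟩ := Real.exists_johansson_parameters hL
    refine ⟨K + (m + 1), G.colorable_of_local_lemma
      (fun a b c => SimpleGraph.not_adj_of_five_le_egirth hG) n (by omega) (fun v => ?_)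
      K l m hK hl hp, hle⟩
    convert (hreg v).trans_le hk.le
  · refine ⟨n, (G.colorable_of_card_neighbors_le k fun v => ?_).mono hk, ?_⟩
    · rw [← hreg v, ← G.card_neighborFinset_eq_degree, ← Set.ncard_coe_finset,
        G.coe_neighborFinset]
      exact le_rfl
    · rw [le_div_iff₀ hlog]
      nlinarith
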